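/- Let I ⊊ {1, …, |V|} and let i ∈ {1, …, |V|} \ I be such that s = bexp_I(N_i) is maximal with respect to G_I. Then the output of a single step of a global algorithm on G_I with s as the maximal string is isomorphic to G_{I ∪ {i}}. -/

import Mathlib

/-- A straight-line grammar (SLG) over terminal alphabet `T` with set of nonterminals `N`:
every nonterminal has exactly one production rule (symbols are `N ⊕ T`). -/
structure SLG (T : Type) (N : Type) where
  start : N
  rhs : N → List (N ⊕ T)

namespace SLG

variable {T N : Type}

/-- One rewriting step: replace one occurrence of a nonterminal by its right-hand side. -/
def Produces (G : SLG T N) (x y : List (N ⊕ T)) : Prop :=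
  ∃ (p q : List (N ⊕ T)) (X : N),
    x = p ++ Sum.inl X :: q ∧ y = p ++ G.rhs X ++ q

/-- The derivation relation of an SLG. -/
def Derives (G : SLG T N) : List (N ⊕ T) → List (N ⊕ T) → Prop :=
  Relation.ReflTransGen G.Produces

/-- `u` is the (necessarily unique) expansion `exp_G(X)` of the nonterminal `X`. -/
def IsExp (G : SLG T N) (X : N) (u : List T) : Prop :=
  G.Derives [Sum.inl X] (u.map Sum.inr)

/-- The language of an SLG; for an SLG it equals `{exp_G(S)}`. -/
def language (G : SLG T N) : Set (List T) :=
  { u | G.IsExp G.start u }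

/-- `Y` occurs in the parse tree of `X`. -/
def Reaches (G : SLG T N) : N → N → Prop :=
  Relation.ReflTransGen (fun X Y => Sum.inl Y ∈ G.rhs X)

/-- An SLG is admissible if every right-hand side consists of exactly two symbols and
every nonterminal occurs in the parse tree of the start symbol. -/
def Admissible (G : SLG T N) : Prop :=
  (∀ X, (G.rhs X).length = 2) ∧ (∀ X, G.Reaches G.start X)

/-- The size of an SLG: the total length of the right-hand sides of all its rules. -/
def size (G : SLG T N) [Fintype N] : ℕ :=
  ∑ X : N, (G.rhs X).length

end SLG

section Bexp

variable {T N : Type} {n : ℕ}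

/-- The bounded expansion `bexp_I`, computed with explicit fuel (for an acyclic grammar
with `n` nonterminals, fuel `n` always suffices).  The output symbols are symbols of the
grammar `G_I`: its nonterminals are `Option {i // i ∈ I}` (`some i` is `M_i`, `none` is `S`)
and its terminals are `Σ'' = T ⊕ Fin n ⊕ Fin (2n)` (terminals of `G`, dollars, hashes). -/
def bexpFuel (G : SLG T N) (e : Fin n ≃ N) (I : Finset (Fin n)) :
    ℕ → (N ⊕ T) → List ((Option {i : Fin n // i ∈ I}) ⊕ (T ⊕ Fin n ⊕ Fin (2 * n)))
  | _, Sum.inr t => [Sum.inr (Sum.inl t)]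
  | 0, Sum.inl _ => []
  | k + 1, Sum.inl X =>
    if h : e.symm X ∈ I then [Sum.inl (some ⟨e.symm X, h⟩)]
    else
      match G.rhs X with
      | [A, B] =>
          bexpFuel G e I k A
            ++ Sum.inr (Sum.inr (Sum.inl (e.symm X))) :: bexpFuel G e I k B
      | _ => []

/-- `bexp_I` applied to a symbol of `G`. -/
def bexp (G : SLG T N) (e : Fin n ≃ N) (I : Finset (Fin n)) (s : N ⊕ T) :
    List ((Option {i : Fin n // i ∈ I}) ⊕ (T ⊕ Fin n ⊕ Fin (2 * n))) :=
  bexpFuel G e I n s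

/-- The grammar `G_I`: nonterminals `{S} ∪ {M_i : i ∈ I}`, rules
`M_i → bexp_I(X) $_i bexp_I(Y)` (where `N_i → X Y` in `G`) and
`S → ⨀_{i=1..|V|} bexp_I(N_i) · #_{2i-1} · bexp_I(N_i) · #_{2i}`. -/
def GI (G : SLG T N) (e : Fin n ≃ N) (I : Finset (Fin n)) :
    SLG (T ⊕ Fin n ⊕ Fin (2 * n)) (Option {i : Fin n // i ∈ I}) where
  start := none
  rhs := fun
    | none => (List.finRange n).flatMap fun i =>
        bexp G e I (Sum.inl (e i))
          ++ Sum.inr (Sum.inr (Sum.inr (⟨2 * i.val, by have := i.isLt; omega⟩ : Fin (2 * n))))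
          :: bexp G e I (Sum.inl (e i))
          ++ [Sum.inr (Sum.inr (Sum.inr
                (⟨2 * i.val + 1, by have := i.isLt; omega⟩ : Fin (2 * n))))]
    | some j =>
        match G.rhs (e j.1) with
        | [A, B] =>
            bexp G e I A ++ Sum.inr (Sum.inr (Sum.inl j.1)) :: bexp G e I B
        | _ => []

end Bexp

section Greedy

variable {A B : Type}

/-- The number of non-overlapping occurrences of `p` in a list, found by the greedy
left-to-right scan (after finding an occurrence at position `i`, the search resumes at
position `i + |p|`). -/
def greedyCount [DecidableEq A] (p : List A) : List A → ℕ
  | [] => 0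
  | a :: t =>
    if p ≠ [] ∧ p <+: (a :: t) then 1 + greedyCount p (t.drop (p.length - 1))
    else greedyCount p t
termination_by l => l.length
decreasing_by
  · simp only [List.length_drop, List.length_cons]; omega
  · simp only [List.length_cons]; omega

/-- Replace the greedily found non-overlapping occurrences of `p` in a list by the single
symbol `c`, mapping all remaining symbols by `f`. -/
def greedyReplace [DecidableEq A] (p : List A) (c : B) (f : A → B) : List A → List B
  | [] => []
  | a :: t =>
    if p ≠ [] ∧ p <+: (a :: t) then c :: greedyReplace p c f (t.drop (p.length - 1))
    else f a :: greedyReplace p c f t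
termination_by l => l.length
decreasing_by
  · simp only [List.length_drop, List.length_cons]; omega
  · simp only [List.length_cons]; omega

end Greedy

namespace SLG

variable {T N : Type}

/-- Total number of non-overlapping occurrences of the string `s` on the right-hand side
of the grammar `H` (greedy left-to-right scan of the definition of every nonterminal). -/
def rhsOccs [Fintype N] [DecidableEq N] [DecidableEq T] (H : SLG T N)
    (s : List (N ⊕ T)) : ℕ :=
  ∑ X : N, greedyCount s (H.rhs X)

/-- `s` is a maximal string with respect to the grammar `H`: it has length at least two,
it has at least two non-overlapping occurrences on the right-hand side of `H`, and no
strictly longer string has at least as many non-overlapping occurrences. -/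
def IsMaximal [Fintype N] [DecidableEq N] [DecidableEq T] (H : SLG T N)
    (s : List (N ⊕ T)) : Prop :=
  2 ≤ s.length ∧ 2 ≤ H.rhsOccs s ∧
    ∀ s' : List (N ⊕ T), s.length < s'.length → H.rhsOccs s' < H.rhsOccs s

/-- A single step of a global algorithm on `H` with chosen maximal string `s`: a fresh
nonterminal (modelled by `none : Option N`) gets `s` as its definition, and the
non-overlapping occurrences of `s` (greedy left-to-right scan) on every right-hand side
are replaced by it. -/
def globalStep [DecidableEq N] [DecidableEq T] (H : SLG T N) (s : List (N ⊕ T)) :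
    SLG T (Option N) where
  start := some H.start
  rhs := fun
    | some X => greedyReplace s (Sum.inl none) (Sum.map some id) (H.rhs X)
    | none => s.map (Sum.map some id)

/-- Isomorphism of SLGs over a common terminal alphabet: a bijection of the nonterminals
(extended by the identity on terminals) mapping start symbol to start symbol and the
right-hand side of every nonterminal symbol-by-symbol onto the right-hand side of its
image. -/
def Isomorphic {N₁ N₂ : Type} (H₁ : SLG T N₁) (H₂ : SLG T N₂) : Prop :=
  ∃ g : N₁ ≃ N₂, g H₁.start = H₂.start ∧
    ∀ X, H₂.rhs (g X) = (H₁.rhs X).map (Sum.map g id)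

/-- Renaming the nonterminals of an SLG along a bijection. -/
def relabel {N₁ N₂ : Type} (H : SLG T N₁) (g : N₁ ≃ N₂) : SLG T N₂ where
  start := g H.start
  rhs Y := (H.rhs (g.symm Y)).map (Sum.map g id)

end SLG

/-- The initial grammar of a global algorithm on the input string `w`: a single
nonterminal whose definition is `w`. -/
def initSLG {T : Type} (w : List T) : SLG T (Fin 1) where
  start := 0
  rhs _ := w.map Sum.inr

/-- `Gs` is (the trace of) a run of `K` steps of a global algorithm on the input
string `w`: it starts with the one-rule grammar for `w` and each step replaces some
maximal string of the current grammar (after each step the nonterminals are renamed to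
`Fin (k + 2)`, which keeps a uniform indexing and does not change the grammar up to
isomorphism). -/
def IsGlobalRun {T : Type} [DecidableEq T] (w : List T) (K : ℕ)
    (Gs : (k : ℕ) → SLG T (Fin (k + 1))) : Prop :=
  Gs 0 = initSLG w ∧
  ∀ k < K, ∃ s, (Gs k).IsMaximal s ∧
    Gs (k + 1) = ((Gs k).globalStep s).relabel (finSuccEquiv (k + 1)).symm

namespace SLG

variable {T N : Type}

/-- Big-step version of the derivation relation: `G.Yields x u` says that replacing every
nonterminal of `x` by its expansion gives the terminal string `u`. -/
inductive Yields (G : SLG T N) : List (N ⊕ T) → List T → Prop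
  | nil : Yields G [] []
  | terminal {t : T} {x : List (N ⊕ T)} {u : List T} :
      Yields G x u → Yields G (Sum.inr t :: x) (t :: u)
  | nonterminal {X : N} {x : List (N ⊕ T)} {u v : List T} :
      Yields G (G.rhs X) u → Yields G x v → Yields G (Sum.inl X :: x) (u ++ v)

theorem Yields.append {G : SLG T N} {x y : List (N ⊕ T)} {u v : List T}
    (hx : G.Yields x u) (hy : G.Yields y v) : G.Yields (x ++ y) (u ++ v) := by
  induction hx with
  | nil => simpa using hy
  | terminal _ ih => exact .terminal ih
  | nonterminal h _ _ ih =>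
    rw [List.append_assoc]
    exact .nonterminal h ih

theorem Yields.exists_of_append {G : SLG T N} {x y : List (N ⊕ T)} {w : List T}
    (h : G.Yields (x ++ y) w) : ∃ u v, w = u ++ v ∧ G.Yields x u ∧ G.Yields y v := by
  induction x generalizing w with
  | nil => exact ⟨[], w, rfl, .nil, h⟩
  | cons a x ih =>
    cases h with
    | terminal h =>
      obtain ⟨u, v, rfl, hu, hv⟩ := ih h
      exact ⟨_ :: u, v, rfl, .terminal hu, hv⟩
    | nonterminal h₁ h =>
      obtain ⟨u, v, rfl, hu, hv⟩ := ih h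
      exact ⟨_ ++ u, v, (List.append_assoc ..).symm, .nonterminal h₁ hu, hv⟩

theorem Yields.unique {G : SLG T N} {x : List (N ⊕ T)} {u v : List T}
    (hu : G.Yields x u) (hv : G.Yields x v) : u = v := by
  induction hu generalizing v with
  | nil => cases hv; rfl
  | terminal _ ih =>
    cases hv with
    | terminal h => rw [ih h]
  | nonterminal _ _ ih₁ ih₂ =>
    cases hv with
    | nonterminal h₁ h₂ => rw [ih₁ h₁, ih₂ h₂]

theorem Yields.map_inr (G : SLG T N) (u : List T) : G.Yields (u.map Sum.inr) u := by
  induction u with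
  | nil => exact .nil
  | cons t u ih => exact .terminal ih

theorem Derives.yields {G : SLG T N} {x : List (N ⊕ T)} {u : List T}
    (h : G.Derives x (u.map Sum.inr)) : G.Yields x u := by
  induction h using Relation.ReflTransGen.head_induction_on with
  | refl => exact Yields.map_inr G u
  | head hstep _ ih =>
    obtain ⟨p, q, X, rfl, rfl⟩ := hstep
    obtain ⟨w, v₃, rfl, hw, h₃⟩ := ih.exists_of_append
    obtain ⟨v₁, v₂, rfl, h₁, h₂⟩ := hw.exists_of_append
    rw [List.append_assoc]
    exact h₁.append (.nonterminal h₂ h₃)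

theorem Yields.length_le {G : SLG T N} (hG : ∀ X, (G.rhs X).length = 2)
    {x : List (N ⊕ T)} {u : List T} (h : G.Yields x u) : x.length ≤ u.length := by
  induction h with
  | nil => simp
  | terminal _ ih => simpa using ih
  | @nonterminal X _ _ _ _ _ ih₁ ih₂ =>
    have := hG X
    simp only [List.length_cons, List.length_append]
    omega

/-- Expansions of the nonterminals on a right-hand side are strictly shorter than the
expansion of the left-hand side. -/
theorem length_exp_lt {G : SLG T N} (hG : ∀ X, (G.rhs X).length = 2) {X Y : N}
    {u v : List T} (hu : G.IsExp X u) (hv : G.IsExp Y v) (hY : Sum.inl Y ∈ G.rhs X) :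
    v.length < u.length := by
  obtain ⟨p, q, hpq⟩ := List.append_of_mem hY
  have hlen := hG X
  cases Derives.yields hu with
  | nonterminal h h' =>
    cases h'
    rw [hpq] at h hlen
    obtain ⟨w₁, w, rfl, h₁, h⟩ := h.exists_of_append
    cases h with
    | nonterminal h₂ h₃ =>
      have := (Yields.nonterminal h₂ .nil).unique (Derives.yields hv)
      have h₁ := h₁.length_le hG
      have h₃ := h₃.length_le hG
      subst this
      simp only [List.length_append, List.length_cons, List.length_nil] at *
      omega

end SLG

section Greedy

variable {A B C : Type} [DecidableEq A]

theorem greedyReplace_append_self {p : List A} (hp : p ≠ []) (c : B) (f : A → B)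
    (l : List A) : greedyReplace p c f (p ++ l) = c :: greedyReplace p c f l := by
  obtain ⟨a, p, rfl⟩ := List.exists_cons_of_ne_nil hp
  rw [List.cons_append, greedyReplace, if_pos ⟨hp, by simp⟩]
  simp

theorem greedyReplace_cons_of_not_isPrefix_cons {p : List A} (c : B) (f : A → B) {a : A}
    {l : List A} (h : ¬ p <+: a :: l) :
    greedyReplace p c f (a :: l) = f a :: greedyReplace p c f l := by
  rw [greedyReplace, if_neg fun h' => h h'.2]

theorem map_greedyReplace (p : List A) (c : B) (f : A → B) (h : B → C) (l : List A) :
    (greedyReplace p c f l).map h = greedyReplace p (h c) (h ∘ f) l := by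
  induction l using greedyReplace.induct p with
  | case1 => simp [greedyReplace]
  | case2 a t hp ih =>
    rw [greedyReplace, if_pos hp, greedyReplace, if_pos hp, List.map_cons, ih]
  | case3 a t hp ih =>
    rw [greedyReplace, if_neg hp, greedyReplace, if_neg hp, List.map_cons, ih]
    rfl

theorem length_le_of_prefix_flatMap {A B : Type} {a b a' b' : List A} {d : A} (hd : d ∉ a) {c : B}
    {f : A → B} {φ : B → List A} (hc : φ c = a ++ d :: b) {l : List B}
    (hl : ∀ x ∈ l, x = c ∨ ∃ y, y ≠ d ∧ x = f y ∧ φ x = [y])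
    (h : a' ++ d :: b' <+: l.flatMap φ) : a.length ≤ a'.length := by
  induction l generalizing a' with
  | nil => simp at h
  | cons x l ih =>
    rcases hl x (by simp) with rfl | ⟨y, hy, -, hφ⟩
    · by_contra! hlt
      obtain ⟨r, hr⟩ := h
      rw [List.flatMap_cons, hc] at hr
      have := congrArg (fun m => m[a'.length]?) hr
      simp [List.getElem?_append, hlt] at this
      exact hd (this ▸ List.getElem_mem hlt)
    · rw [List.flatMap_cons, hφ, List.singleton_append] at h
      cases a' with
      | nil => exact absurd (List.cons_prefix_cons.1 h).1.symm hy
      | cons z a' =>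
        have := ih (fun x hx => hl x (List.mem_cons_of_mem _ hx)) (List.cons_prefix_cons.1 h).2
        simp only [List.length_cons]
        omega

/-- If `p` contains a letter `d` that occurs in a string only inside designated blocks
equal to `p`, then the greedy scan for `p` replaces precisely these blocks. -/
theorem greedyReplace_flatMap {a b p : List A} {d : A} (hp : p = a ++ d :: b) (hd : d ∉ a)
    {c : B} {f : A → B} {φ : B → List A} (hc : φ c = p) {l : List B}
    (hl : ∀ x ∈ l, x = c ∨ ∃ y, y ≠ d ∧ x = f y ∧ φ x = [y]) :
    greedyReplace p c f (l.flatMap φ) = l := by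
  induction l with
  | nil => simp [greedyReplace]
  | cons x l ih =>
    have hl' := fun x hx => hl x (List.mem_cons_of_mem _ hx)
    rw [List.flatMap_cons]
    rcases hl x (by simp) with rfl | ⟨y, hy, hx, hφ⟩
    · rw [hc, greedyReplace_append_self (by simp [hp]), ih hl']
    · rw [hφ, List.singleton_append, greedyReplace_cons_of_not_isPrefix_cons, ih hl', ← hx]
      subst hp
      intro h
      cases a with
      | nil => exact hy (List.cons_prefix_cons.1 h).1.symm
      | cons z a =>
        have := length_le_of_prefix_flatMap hd hc hl' (List.cons_prefix_cons.1 h).2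
        simp at this

end Greedy

section Bexp

variable {T N : Type} {n : ℕ}

/-- Structural induction on the symbols of a grammar whose right-hand sides have length
two and contain only nonterminals preceding the left-hand side. -/
theorem symbol_induction {G : SLG T N} {e : Fin n ≃ N} (hG : ∀ X, (G.rhs X).length = 2)
    (hlt : ∀ X Y, Sum.inl Y ∈ G.rhs X → e.symm Y < e.symm X) {P : N ⊕ T → Prop}
    (terminal : ∀ t, P (Sum.inr t))
    (nonterminal : ∀ X A B, G.rhs X = [A, B] → P A → P B → P (Sum.inl X)) :
    ∀ s, P s := by
  have key : ∀ (k : ℕ) (X : N), (e.symm X : ℕ) < k → P (Sum.inl X) := by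
    intro k
    induction k with
    | zero => intro X h; omega
    | succ k ih =>
      intro X hX
      obtain ⟨A, B, hAB⟩ := List.length_eq_two.1 (hG X)
      have hmem : ∀ s ∈ G.rhs X, P s := by
        rintro (Y | t) hY
        · have := Fin.lt_def.1 (hlt X Y hY)
          exact ih Y (by omega)
        · exact terminal t
      exact nonterminal X A B hAB (hmem A (by simp [hAB])) (hmem B (by simp [hAB]))
  rintro (X | t)
  · exact key _ X (Nat.lt_succ_self _)
  · exact terminal t

theorem bexpFuel_inr (G : SLG T N) (e : Fin n ≃ N) (I : Finset (Fin n)) (k : ℕ) (t : T) :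
    bexpFuel G e I k (Sum.inr t) = [Sum.inr (Sum.inl t)] := by
  cases k <;> rfl

theorem bexp_inr (G : SLG T N) (e : Fin n ≃ N) (I : Finset (Fin n)) (t : T) :
    bexp G e I (Sum.inr t) = [Sum.inr (Sum.inl t)] :=
  bexpFuel_inr G e I n t

theorem bexpFuel_eq {G : SLG T N} {e : Fin n ≃ N} (hG : ∀ X, (G.rhs X).length = 2)
    (hlt : ∀ X Y, Sum.inl Y ∈ G.rhs X → e.symm Y < e.symm X) (I : Finset (Fin n))
    {k k' : ℕ} (s : N ⊕ T) (hk : ∀ X, s = Sum.inl X → (e.symm X : ℕ) < k)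
    (hk' : ∀ X, s = Sum.inl X → (e.symm X : ℕ) < k') :
    bexpFuel G e I k s = bexpFuel G e I k' s := by
  induction s using symbol_induction hG hlt generalizing k k' with
  | terminal t => rw [bexpFuel_inr, bexpFuel_inr]
  | nonterminal X A B hAB ihA ihB =>
    have h := hk X rfl
    have h' := hk' X rfl
    obtain ⟨k, rfl⟩ := Nat.exists_eq_succ_of_ne_zero (by omega : k ≠ 0)
    obtain ⟨k', rfl⟩ := Nat.exists_eq_succ_of_ne_zero (by omega : k' ≠ 0)
    have hsub : ∀ Y, Sum.inl Y ∈ G.rhs X → (e.symm Y : ℕ) < k ∧ (e.symm Y : ℕ) < k' := by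
      intro Y hY
      have := Fin.lt_def.1 (hlt X Y hY)
      omega
    have hA := ihA (k := k) (k' := k') (fun Y hY => (hsub Y (by simp [hAB, hY])).1)
      (fun Y hY => (hsub Y (by simp [hAB, hY])).2)
    have hB := ihB (k := k) (k' := k') (fun Y hY => (hsub Y (by simp [hAB, hY])).1)
      (fun Y hY => (hsub Y (by simp [hAB, hY])).2)
    simp only [bexpFuel, hAB, hA, hB]

theorem bexp_inl_of_mem (G : SLG T N) (e : Fin n ≃ N) {I : Finset (Fin n)} {X : N}
    (h : e.symm X ∈ I) : bexp G e I (Sum.inl X) = [Sum.inl (some ⟨e.symm X, h⟩)] := by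
  obtain ⟨k, rfl⟩ := Nat.exists_eq_succ_of_ne_zero (by have := (e.symm X).isLt; omega : n ≠ 0)
  simp only [bexp, bexpFuel, h, dite_true]

theorem bexp_inl_of_notMem {G : SLG T N} {e : Fin n ≃ N} (hG : ∀ X, (G.rhs X).length = 2)
    (hlt : ∀ X Y, Sum.inl Y ∈ G.rhs X → e.symm Y < e.symm X) {I : Finset (Fin n)} {X : N}
    {A B : N ⊕ T} (hAB : G.rhs X = [A, B]) (h : e.symm X ∉ I) :
    bexp G e I (Sum.inl X)
      = bexp G e I A ++ Sum.inr (Sum.inr (Sum.inl (e.symm X))) :: bexp G e I B := by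
  have hX := (e.symm X).isLt
  have hn : bexp G e I (Sum.inl X) = bexpFuel G e I (n + 1) (Sum.inl X) :=
    bexpFuel_eq hG hlt I _ (fun Y _ => (e.symm Y).isLt)
      (fun Y _ => (e.symm Y).isLt.trans (Nat.lt_succ_self n))
  rw [hn]
  simp only [bexpFuel, hAB, h, dite_false, bexp]

theorem GI_rhs_some (G : SLG T N) (e : Fin n ≃ N) (I : Finset (Fin n))
    (j : {i : Fin n // i ∈ I}) {A B : N ⊕ T} (hAB : G.rhs (e j.1) = [A, B]) :
    (GI G e I).rhs (some j)
      = bexp G e I A ++ Sum.inr (Sum.inr (Sum.inl j.1)) :: bexp G e I B := by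
  simp only [GI, hAB]

/-- The symbols of `G_I`, seen as symbols of `G_{I ∪ {i}}`. -/
def insertSym (I : Finset (Fin n)) (i : Fin n) :
    (Option {j : Fin n // j ∈ I}) ⊕ (T ⊕ Fin n ⊕ Fin (2 * n)) →
      (Option {j : Fin n // j ∈ insert i I}) ⊕ (T ⊕ Fin n ⊕ Fin (2 * n)) :=
  Sum.map (Option.map fun j => ⟨j.1, Finset.mem_insert_of_mem j.2⟩) id

/-- The substitution on symbols of `G_{I ∪ {i}}` that replaces `M_i` by the string `s` over
the symbols of `G_I` and keeps all other symbols. -/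
def unfoldSym (I : Finset (Fin n)) (i : Fin n)
    (s : List ((Option {j : Fin n // j ∈ I}) ⊕ (T ⊕ Fin n ⊕ Fin (2 * n)))) :
    (Option {j : Fin n // j ∈ insert i I}) ⊕ (T ⊕ Fin n ⊕ Fin (2 * n)) →
      List ((Option {j : Fin n // j ∈ I}) ⊕ (T ⊕ Fin n ⊕ Fin (2 * n)))
  | Sum.inl none => [Sum.inl none]
  | Sum.inl (some j) => if h : j.1 ∈ I then [Sum.inl (some ⟨j.1, h⟩)] else s
  | Sum.inr t => [Sum.inr t]

theorem unfoldSym_cases {I : Finset (Fin n)} {i : Fin n}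
    (s : List ((Option {j : Fin n // j ∈ I}) ⊕ (T ⊕ Fin n ⊕ Fin (2 * n))))
    {x : (Option {j : Fin n // j ∈ insert i I}) ⊕ (T ⊕ Fin n ⊕ Fin (2 * n))}
    (hx : x ≠ Sum.inr (Sum.inr (Sum.inl i))) :
    x = Sum.inl (some ⟨i, Finset.mem_insert_self i I⟩) ∨
      ∃ y, y ≠ Sum.inr (Sum.inr (Sum.inl i)) ∧ x = insertSym I i y ∧
        unfoldSym I i s x = [y] := by
  rcases x with (_ | ⟨j, hj⟩) | t
  · exact .inr ⟨Sum.inl none, by simp, rfl, rfl⟩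
  · by_cases h : j ∈ I
    · exact .inr ⟨Sum.inl (some ⟨j, h⟩), by simp, rfl, by simp [unfoldSym, h]⟩
    · obtain rfl : j = i := (Finset.mem_insert.1 hj).resolve_right h
      exact .inl rfl
  · exact .inr ⟨Sum.inr t, by simpa using hx, rfl, rfl⟩

theorem dollar_notMem_bexp {G : SLG T N} {e : Fin n ≃ N} (hG : ∀ X, (G.rhs X).length = 2)
    (hlt : ∀ X Y, Sum.inl Y ∈ G.rhs X → e.symm Y < e.symm X) {I : Finset (Fin n)}
    {i : Fin n} (hi : i ∈ I) (s : N ⊕ T) :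
    Sum.inr (Sum.inr (Sum.inl i)) ∉ bexp G e I s := by
  induction s using symbol_induction hG hlt with
  | terminal t => simp [bexp_inr]
  | nonterminal X A B hAB ihA ihB =>
    by_cases h : e.symm X ∈ I
    · simp [bexp_inl_of_mem G e h]
    · have : i ≠ e.symm X := fun h' => h (h' ▸ hi)
      simp [bexp_inl_of_notMem hG hlt hAB h, ihA, ihB, this]

theorem dollar_notMem_GI_rhs {G : SLG T N} {e : Fin n ≃ N}
    (hG : ∀ X, (G.rhs X).length = 2)
    (hlt : ∀ X Y, Sum.inl Y ∈ G.rhs X → e.symm Y < e.symm X) {I : Finset (Fin n)}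
    {i : Fin n} (hi : i ∈ I) {j : Option {j : Fin n // j ∈ I}} (hj : j ≠ some ⟨i, hi⟩) :
    Sum.inr (Sum.inr (Sum.inl i)) ∉ (GI G e I).rhs j := by
  have hd := dollar_notMem_bexp hG hlt hi
  rcases j with _ | ⟨j, hjI⟩
  · simp [GI, hd]
  · obtain ⟨A, B, hAB⟩ := List.length_eq_two.1 (hG (e j))
    rw [GI_rhs_some G e I ⟨j, hjI⟩ hAB]
    have : i ≠ j := by rintro rfl; exact hj rfl
    simp [hd, this]

theorem flatMap_unfoldSym_bexp {G : SLG T N} {e : Fin n ≃ N}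
    (hG : ∀ X, (G.rhs X).length = 2)
    (hlt : ∀ X Y, Sum.inl Y ∈ G.rhs X → e.symm Y < e.symm X) {I : Finset (Fin n)}
    {i : Fin n} (hi : i ∉ I) (s : N ⊕ T) :
    (bexp G e (insert i I) s).flatMap (unfoldSym I i (bexp G e I (Sum.inl (e i))))
      = bexp G e I s := by
  induction s using symbol_induction hG hlt with
  | terminal t => simp [bexp_inr, unfoldSym]
  | nonterminal X A B hAB ihA ihB =>
    by_cases h : e.symm X ∈ insert i I
    · rw [bexp_inl_of_mem G e h]
      by_cases h' : e.symm X ∈ I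
      · simp [unfoldSym, h', bexp_inl_of_mem G e h']
      · obtain rfl := (Finset.mem_insert.1 h).resolve_right h'
        simp [unfoldSym, hi]
    · have h' : e.symm X ∉ I := fun h' => h (Finset.mem_insert_of_mem h')
      rw [bexp_inl_of_notMem hG hlt hAB h, bexp_inl_of_notMem hG hlt hAB h']
      simp [ihA, ihB, unfoldSym]

theorem flatMap_unfoldSym_GI_rhs {G : SLG T N} {e : Fin n ≃ N}
    (hG : ∀ X, (G.rhs X).length = 2)
    (hlt : ∀ X Y, Sum.inl Y ∈ G.rhs X → e.symm Y < e.symm X) {I : Finset (Fin n)}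
    {i : Fin n} (hi : i ∉ I) (j : Option {j : Fin n // j ∈ I}) :
    ((GI G e (insert i I)).rhs (j.map fun j => ⟨j.1, Finset.mem_insert_of_mem j.2⟩)).flatMap
        (unfoldSym I i (bexp G e I (Sum.inl (e i))))
      = (GI G e I).rhs j := by
  have hb := flatMap_unfoldSym_bexp hG hlt hi
  rcases j with _ | ⟨j, hj⟩
  · simp [GI, List.flatMap_assoc, hb, unfoldSym]
  · obtain ⟨A, B, hAB⟩ := List.length_eq_two.1 (hG (e j))
    rw [GI_rhs_some G e I ⟨j, hj⟩ hAB, Option.map_some,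
      GI_rhs_some G e _ ⟨j, Finset.mem_insert_of_mem hj⟩ hAB]
    simp [hb, unfoldSym]

/-- Below `N_i`, inserting `i` into `I` does not change the bounded expansion. -/
theorem map_insertSym_bexp {G : SLG T N} {e : Fin n ≃ N} (hG : ∀ X, (G.rhs X).length = 2)
    (hlt : ∀ X Y, Sum.inl Y ∈ G.rhs X → e.symm Y < e.symm X) (I : Finset (Fin n))
    {i : Fin n} (s : N ⊕ T) (hs : ∀ X, s = Sum.inl X → e.symm X < i) :
    (bexp G e I s).map (insertSym I i) = bexp G e (insert i I) s := by
  induction s using symbol_induction hG hlt with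
  | terminal t => simp [bexp_inr, insertSym]
  | nonterminal X A B hAB ihA ihB =>
    have hX := hs X rfl
    by_cases h : e.symm X ∈ I
    · rw [bexp_inl_of_mem G e h, bexp_inl_of_mem G e (Finset.mem_insert_of_mem h)]
      rfl
    · have h' : e.symm X ∉ insert i I := by simp [h, hX.ne]
      rw [bexp_inl_of_notMem hG hlt hAB h, bexp_inl_of_notMem hG hlt hAB h',
        ← ihA fun Y hY => (hlt X Y (by simp [hAB, hY])).trans hX,
        ← ihB fun Y hY => (hlt X Y (by simp [hAB, hY])).trans hX]
      simp [insertSym]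

/-- The nonterminals of a global step on `G_I` correspond to those of `G_{I ∪ {i}}`, the
fresh one to `M_i`. -/
def insertEquiv {I : Finset (Fin n)} {i : Fin n} (hi : i ∉ I) :
    Option (Option {j : Fin n // j ∈ I}) ≃ Option {j : Fin n // j ∈ insert i I} where
  toFun
    | none => some ⟨i, Finset.mem_insert_self i I⟩
    | some j => j.map fun j => ⟨j.1, Finset.mem_insert_of_mem j.2⟩
  invFun
    | none => some none
    | some j => if h : j.1 ∈ I then some (some ⟨j.1, h⟩) else none
  left_inv := by
    rintro (_ | _ | ⟨j, hj⟩)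
    · simp [hi]
    · rfl
    · simp [hj]
  right_inv := by
    rintro (_ | ⟨j, hj⟩)
    · rfl
    · by_cases h : j ∈ I
      · simp [h]
      · obtain rfl : j = i := (Finset.mem_insert.1 hj).resolve_right h
        simp [h]

end Bexp

/-- Let `I ⊊ {1, …, |V|}` and `i ∈ {1, …, |V|} \ I` be such that
`s = bexp_I(N_i)` is maximal with respect to `G_I`.  Then the output of a single step of
a global algorithm on `G_I` with `s` as the maximal string is isomorphic to `G_{I ∪ {i}}`. -/
theorem GI_one_step {T N : Type} [DecidableEq T] [Fintype N] {n : ℕ}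
    (e : Fin n ≃ N) (G : SLG T N) (hG : G.Admissible)
    (expn : N → List T) (hexpn : ∀ X, G.IsExp X (expn X))
    (hord : ∀ i j : Fin n, i ≤ j → (expn (e i)).length ≤ (expn (e j)).length)
    (I : Finset (Fin n)) (hI : I ≠ Finset.univ) (i : Fin n) (hi : i ∉ I)
    (hmax : (GI G e I).IsMaximal (bexp G e I (Sum.inl (e i)))) :
    ((GI G e I).globalStep (bexp G e I (Sum.inl (e i)))).Isomorphic
      (GI G e (insert i I)) := by
  have hlt : ∀ X Y, Sum.inl Y ∈ G.rhs X → e.symm Y < e.symm X := by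
    intro X Y hY
    by_contra! hle
    have hle := hord _ _ hle
    have hXY := SLG.length_exp_lt hG.1 (hexpn X) (hexpn Y) hY
    simp only [Equiv.apply_symm_apply] at hle
    omega
  obtain ⟨A, B, hAB⟩ := List.length_eq_two.1 (hG.1 (e i))
  have hs : bexp G e I (Sum.inl (e i))
      = bexp G e I A ++ Sum.inr (Sum.inr (Sum.inl i)) :: bexp G e I B := by
    simpa using bexp_inl_of_notMem hG.1 hlt hAB (I := I) (by simpa using hi)
  have hchild : ∀ Y, Sum.inl Y ∈ G.rhs (e i) → e.symm Y < i := by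
    intro Y hY
    simpa using hlt _ _ hY
  have hA := map_insertSym_bexp hG.1 hlt I A fun Y hY => hchild Y (by simp [hAB, hY])
  have hB := map_insertSym_bexp hG.1 hlt I B fun Y hY => hchild Y (by simp [hAB, hY])
  have hdA : Sum.inr (Sum.inr (Sum.inl i)) ∉ bexp G e I A := fun h =>
    dollar_notMem_bexp hG.1 hlt (Finset.mem_insert_self i I) A
      (hA ▸ List.mem_map_of_mem (f := insertSym I i) h)
  have hsym : Sum.map (insertEquiv hi) id ∘ Sum.map some id = insertSym (T := T) I i := by
    funext x
    rcases x with x | t <;> rfl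
  refine ⟨insertEquiv hi, rfl, ?_⟩
  rintro (_ | j)
  · change _ = List.map _ (List.map _ _)
    rw [List.map_map, hsym, hs]
    refine (GI_rhs_some G e _ ⟨i, Finset.mem_insert_self i I⟩ hAB).trans ?_
    simp only [List.map_append, List.map_cons, hA, hB]
    rfl
  · change _ = List.map _ (greedyReplace _ _ _ _)
    rw [map_greedyReplace, hsym, ← flatMap_unfoldSym_GI_rhs hG.1 hlt hi j]
    symm
    refine greedyReplace_flatMap hs hdA (by simp [unfoldSym, insertEquiv, hi]) fun x hx => ?_
    refine unfoldSym_cases _ ?_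
    rintro rfl
    refine dollar_notMem_GI_rhs hG.1 hlt (Finset.mem_insert_self i I) ?_ hx
    rcases j with _ | ⟨j, hj⟩
    · simp
    · have : j ≠ i := by rintro rfl; exact hi hj
      simpa using this
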